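/- Let p : X → [0,1] be measurable on (X, P_X), U uniform on [0,1], and R = ∫_X 1_{p(x) > U} P_X(dx). Then Var[R] = ∫_X η(x) P_X(dx), where η(x) = (1 − p(x)) ∫_X p(y) 1_{p(y) ≤ p(x)} P_X(dy) + p(x) ∫_X (1 − p(y)) 1_{p(y) > p(x)} P_X(dy). -/

import Mathlib

open MeasureTheory ProbabilityTheory

theorem aux_level_meas
    {Ω Z : Type*} [MeasurableSpace Ω] [MeasurableSpace Z]
    (ν : Measure Z) [IsProbabilityMeasure ν]
    (f : Z → ℝ) (hf : Measurable f) (U : Ω → ℝ) (hUm : Measurable U) :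
    Measurable (fun ω => ν.real {z | U ω < f z}) := by
  have hS : MeasurableSet {q : Ω × Z | U q.1 < f q.2} :=
    measurableSet_lt (hUm.comp measurable_fst) (hf.comp measurable_snd)
  exact (measurable_measure_prodMk_left (ν := ν) hS).ennreal_toReal

theorem aux_level_integral
    {Ω Z : Type*} [MeasurableSpace Ω] [MeasurableSpace Z]
    (P : Measure Ω) [IsProbabilityMeasure P]
    (ν : Measure Z) [IsProbabilityMeasure ν]
    (f : Z → ℝ) (hf : Measurable f) (hf01 : ∀ x, f x ∈ Set.Icc (0:ℝ) 1)
    (U : Ω → ℝ) (hUm : Measurable U)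
    (hU : Measure.map U P = volume.restrict (Set.Icc (0:ℝ) 1)) :
    ∫ ω, ν.real {z | U ω < f z} ∂P = ∫ z, f z ∂ν := by
  have hS : MeasurableSet {q : Ω × Z | U q.1 < f q.2} :=
    measurableSet_lt (hUm.comp measurable_fst) (hf.comp measurable_snd)
  have h1 : ∀ ω, ν.real {z | U ω < f z}
      = ∫ z, Set.indicator {q : Ω × Z | U q.1 < f q.2} (fun _ => (1:ℝ)) (ω, z) ∂ν := by
    intro ω
    have hm : MeasurableSet {z | U ω < f z} := measurableSet_lt measurable_const hf
    rw [← integral_indicator_one hm]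
    rfl
  have h2 : ∀ z, ∫ ω, Set.indicator {q : Ω × Z | U q.1 < f q.2} (fun _ => (1:ℝ)) (ω, z) ∂P
      = f z := by
    intro z
    have hm : MeasurableSet {ω | U ω < f z} := measurableSet_lt hUm measurable_const
    have h3 : ∫ ω, Set.indicator {q : Ω × Z | U q.1 < f q.2} (fun _ => (1:ℝ)) (ω, z) ∂P
        = P.real {ω | U ω < f z} := by
      rw [← integral_indicator_one hm]
      rfl
    rw [h3]
    have h4 : P {ω | U ω < f z} = (Measure.map U P) (Set.Iio (f z)) := by
      rw [Measure.map_apply hUm measurableSet_Iio]; rfl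
    have h5 : Set.Iio (f z) ∩ Set.Icc (0:ℝ) 1 = Set.Ico 0 (f z) := by
      ext t
      have := (hf01 z).2
      simp only [Set.mem_inter_iff, Set.mem_Iio, Set.mem_Icc, Set.mem_Ico]
      constructor
      · rintro ⟨a, b, c⟩; exact ⟨b, a⟩
      · rintro ⟨a, b⟩; exact ⟨b, a, by linarith⟩
    rw [measureReal_def, h4, hU, Measure.restrict_apply measurableSet_Iio, h5, Real.volume_Ico,
      sub_zero, ENNReal.toReal_ofReal (hf01 z).1]
  simp_rw [h1]
  rw [integral_integral_swap]
  · simp_rw [h2]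
  · exact (integrable_const (1:ℝ)).indicator hS

theorem stmt_15
    {Ω X : Type*} [MeasurableSpace Ω] [MeasurableSpace X]
    (P : Measure Ω) [IsProbabilityMeasure P]
    (μ : Measure X) [IsProbabilityMeasure μ]
    (p : X → ℝ) (hpm : Measurable p) (hp01 : ∀ x, p x ∈ Set.Icc (0:ℝ) 1)
    (U : Ω → ℝ) (hUm : Measurable U)
    (hU : Measure.map U P = volume.restrict (Set.Icc (0:ℝ) 1))
    (R : Ω → ℝ) (hR : ∀ ω, R ω = (μ {x | U ω < p x}).toReal)
    (η : X → ℝ)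
    (hη : ∀ x, η x =
      (1 - p x) * (∫ y, p y * (if p y ≤ p x then 1 else 0) ∂μ) +
      p x * (∫ y, (1 - p y) * (if p x < p y then 1 else 0) ∂μ)) :
    variance R P = ∫ x, η x ∂μ := by
  obtain rfl : R = fun ω => μ.real {x | U ω < p x} := funext hR
  have hmeas := aux_level_meas μ p hpm U hUm
  have hL : MemLp (fun ω => μ.real {x | U ω < p x}) 2 P := by
    refine MemLp.of_bound hmeas.aestronglyMeasurable 1 (Filter.Eventually.of_forall fun ω => ?_)
    rw [Real.norm_of_nonneg measureReal_nonneg]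
    exact measureReal_le_one
  have hE := aux_level_integral P μ p hpm hp01 U hUm hU
  have hmin : Measurable (fun z : X × X => min (p z.1) (p z.2)) :=
    (hpm.comp measurable_fst).min (hpm.comp measurable_snd)
  have hE2 := aux_level_integral P (μ.prod μ) (fun z => min (p z.1) (p z.2)) hmin
    (fun z => ⟨le_min (hp01 _).1 (hp01 _).1, (min_le_left _ _).trans (hp01 _).2⟩) U hUm hU
  have hsq : ∀ ω, (μ.prod μ).real {z | U ω < min (p z.1) (p z.2)}
      = (μ.real {x | U ω < p x}) ^ 2 := by
    intro ω
    have : {z : X × X | U ω < min (p z.1) (p z.2)} = {x | U ω < p x} ×ˢ {x | U ω < p x} := by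
      ext z; simp [lt_min_iff]
    rw [this, measureReal_prod_prod, sq]
  simp_rw [hsq] at hE2
  have bdd : ∀ {Z : Type _} [MeasurableSpace Z] (ν : Measure Z) [IsProbabilityMeasure ν]
      (g : Z → ℝ), Measurable g → (∀ z, g z ∈ Set.Icc (0:ℝ) 1) → Integrable g ν := by
    intro Z _ ν _ g hg hb
    refine Integrable.of_bound hg.aestronglyMeasurable 1 (Filter.Eventually.of_forall fun z => ?_)
    rw [Real.norm_of_nonneg (hb z).1]; exact (hb z).2
  have hImin : Integrable (fun z : X × X => min (p z.1) (p z.2)) (μ.prod μ) :=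
    bdd _ _ hmin
      (fun z => ⟨le_min (hp01 _).1 (hp01 _).1, (min_le_left _ _).trans (hp01 _).2⟩)
  have hImul : Integrable (fun z : X × X => p z.1 * p z.2) (μ.prod μ) :=
    (bdd μ p hpm hp01).mul_prod (bdd μ p hpm hp01)
  have hη2 : ∀ x, η x = ∫ y, (min (p x) (p y) - p x * p y) ∂μ := by
    intro x
    rw [hη, ← integral_const_mul, ← integral_const_mul, ← integral_add]
    · congr 1
      ext y
      rcases le_or_gt (p y) (p x) with h | h
      · simp only [h, if_true, not_lt.2 h, if_false, min_eq_right]; ring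
      · simp only [h, if_true, not_le.2 h, if_false, min_eq_left h.le]; ring
    · refine (bdd μ _ ?_ ?_).const_mul _
      · exact hpm.mul (Measurable.ite (measurableSet_le hpm measurable_const)
          measurable_const measurable_const)
      · intro y
        have := hp01 y
        split_ifs <;> simp_all
    · refine (bdd μ _ ?_ ?_).const_mul _
      · exact (measurable_const.sub hpm).mul
          (Measurable.ite (measurableSet_lt measurable_const hpm)
          measurable_const measurable_const)
      · intro y
        have := hp01 y
        split_ifs <;> simp_all
  rw [variance_eq_sub hL, hE]
  have e : P[(fun ω => μ.real {x | U ω < p x}) ^ 2]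
      = ∫ z, min (p z.1) (p z.2) ∂(μ.prod μ) := hE2
  rw [e]
  simp_rw [hη2]
  rw [← integral_prod (fun z : X × X => min (p z.1) (p z.2) - p z.1 * p z.2) (hImin.sub hImul),
    integral_sub hImin hImul, integral_prod_mul, sq]
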